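/- arXiv:1210.2150 — 2 statements merged into one kernel-verified Lean document; each statement's English description precedes it below -/
import Mathlib

section
/- Let Q be a finite simple quandle whose cardinality is not a prime power, and let G = Inn Q be its inner automorphism group. Then every proper quotient of G is cyclic; that is, for every nontrivial normal subgroup N of G, the quotient group G/N is cyclic. -/
universe u v

/-- A quandle: a set with a binary operation `◃` such that every right
translation `x ↦ x ◃ a` is bijective, the operation is right self-distributive,
and every element is idempotent. -/
class Quandle' (Q : Type u) where
  act : Q → Q → Q
  act_bijective : ∀ a : Q, Function.Bijective fun x => act x a
  act_distrib : ∀ a b c : Q, act (act a b) c = act (act a c) (act b c)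
  act_self : ∀ a : Q, act a a = a

infixl:65 " ◃ " => Quandle'.act

namespace Quandle'

/-- The right translation by `a`, as a permutation of the quandle. -/
noncomputable def rho {Q : Type u} [Quandle' Q] (a : Q) : Equiv.Perm Q :=
  Equiv.ofBijective _ (act_bijective a)

/-- The inner automorphism group of a quandle: the subgroup of the symmetric
group generated by the right translations. -/
noncomputable def Inn (Q : Type u) [Quandle' Q] : Subgroup (Equiv.Perm Q) :=
  Subgroup.closure (Set.range (rho : Q → Equiv.Perm Q))

/-- A quandle is connected if its inner automorphism group acts transitively. -/
def IsConnected (Q : Type u) [Quandle' Q] : Prop :=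
  ∀ x y : Q, ∃ g ∈ Inn Q, g x = y

/-- Quandle homomorphisms. -/
def IsHom {Q : Type u} {R : Type v} [Quandle' Q] [Quandle' R] (f : Q → R) : Prop :=
  ∀ a b : Q, f (a ◃ b) = f a ◃ f b

/-- A quandle is simple if it has more than one element and every quandle
homomorphism out of it is either injective or constant. -/
def IsSimple (Q : Type u) [Quandle' Q] : Prop :=
  Nontrivial Q ∧ ∀ (R : Type u) [Quandle' R] (f : Q → R), IsHom f →
    Function.Injective f ∨ ∀ a b : Q, f a = f b

/-- A block for the action of the inner automorphism group. -/
noncomputable def IsBlock (Q : Type u) [Quandle' Q] (B : Set Q) : Prop :=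
  ∀ g ∈ Inn Q, ⇑g '' B = B ∨ Disjoint (⇑g '' B) B

/-- A connected quandle is primitive if the action of its inner automorphism
group preserves no nontrivial partition into blocks. -/
noncomputable def IsPrimitive (Q : Type u) [Quandle' Q] : Prop :=
  IsConnected Q ∧ ∀ B : Set Q, IsBlock Q B → B.Subsingleton ∨ B = Set.univ

end Quandle'

open Quandle'

/-- The conjugacy class of transpositions in the symmetric group `S₅`. -/
abbrev Transposition5 : Type := {σ : Equiv.Perm (Fin 5) // σ.IsSwap}

/-- The conjugation quandle structure `a ◃ b = b⁻¹ * a * b` on the class of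
transpositions of `S₅`. -/
instance : Quandle' Transposition5 where
  act a b := ⟨b.1⁻¹ * a.1 * b.1, by
    obtain ⟨x, y, hxy, ha⟩ := a.2
    refine ⟨b.1⁻¹ x, b.1⁻¹ y, fun h => hxy (b.1⁻¹.injective h), ?_⟩
    rw [ha, Equiv.swap_apply_apply]
    group⟩
  act_bijective a := by
    constructor
    · intro x y h
      have := Subtype.ext_iff.mp h
      simp only [mul_left_cancel_iff, mul_right_cancel_iff] at this
      exact Subtype.ext this
    · intro y
      refine ⟨⟨a.1 * y.1 * a.1⁻¹, ?_⟩, Subtype.ext (by group)⟩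
      obtain ⟨x, z, hxz, hy⟩ := y.2
      refine ⟨a.1 x, a.1 z, fun h => hxz (a.1.injective h), ?_⟩
      rw [hy, Equiv.swap_apply_apply]
  act_distrib a b c := Subtype.ext (by simp only []; group)
  act_self a := Subtype.ext (by simp only []; group)

namespace Quandle'

variable {Q : Type u} [Quandle' Q]

theorem rho_apply (a x : Q) : rho a x = x ◃ a := rfl

theorem rho_mem_Inn (a : Q) : rho a ∈ Inn Q :=
  Subgroup.subset_closure ⟨a, rfl⟩

/-- Inner automorphisms are quandle homomorphisms. -/
theorem isHom_of_mem_Inn {g : Equiv.Perm Q} (hg : g ∈ Inn Q) : IsHom g := by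
  induction hg using Subgroup.closure_induction with
  | mem g hg =>
    obtain ⟨c, rfl⟩ := hg
    exact fun a b => act_distrib a b c
  | one => exact fun _ _ => rfl
  | mul g h _ _ ihg ihh =>
    intro a b
    simp only [Equiv.Perm.mul_apply]
    rw [ihh, ihg]
  | inv g _ ih =>
    intro a b
    apply g.injective
    rw [ih]
    simp only [Equiv.Perm.inv_def, Equiv.apply_symm_apply]

theorem rho_apply_eq_conj {g : Equiv.Perm Q} (hg : g ∈ Inn Q) (a : Q) :
    rho (g a) = g * rho a * g⁻¹ := by
  ext x
  simp only [Equiv.Perm.mul_apply, rho_apply, isHom_of_mem_Inn hg _ a,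
    Equiv.Perm.inv_def, Equiv.apply_symm_apply]

/-- The right translation by `a`, as an inner automorphism. -/
noncomputable def innRho (a : Q) : Inn Q := ⟨rho a, rho_mem_Inn a⟩

theorem innRho_smul (g : Inn Q) (a : Q) : innRho (g • a) = g * innRho a * g⁻¹ :=
  Subtype.ext (rho_apply_eq_conj g.2 a)

theorem closure_range_innRho : Subgroup.closure (Set.range (innRho : Q → Inn Q)) = ⊤ := by
  have hrange : Set.range (innRho : Q → Inn Q) = (Subtype.val : Inn Q → _) ⁻¹' Set.range rho := by
    ext g
    simp only [Set.mem_range, Set.mem_preimage, Subtype.ext_iff, innRho]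
  rw [hrange]
  exact Subgroup.closure_closure_coe_preimage

section OrbitQuotient

variable (N : Subgroup (Inn Q)) [hN : N.Normal]

theorem innRho_smul_mem_orbit_iff (a x y : Q) :
    innRho a • x ∈ MulAction.orbit N (innRho a • y) ↔ x ∈ MulAction.orbit N y := by
  constructor
  · rintro ⟨n, hn⟩
    refine ⟨⟨_, hN.conj_mem' _ n.2 (innRho a)⟩, ?_⟩
    replace hn : (n : Inn Q) • innRho a • y = innRho a • x := hn
    change ((innRho a)⁻¹ * (n : Inn Q) * innRho a) • y = x
    rw [mul_smul, mul_smul, hn, inv_smul_smul]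
  · rintro ⟨n, hn⟩
    refine ⟨⟨_, hN.conj_mem _ n.2 (innRho a)⟩, ?_⟩
    replace hn : (n : Inn Q) • y = x := hn
    change (innRho a * (n : Inn Q) * (innRho a)⁻¹) • innRho a • y = _
    rw [mul_smul, mul_smul, inv_smul_smul, hn]

theorem innRho_smul_mem_orbit {a b : Q} (h : a ∈ MulAction.orbit N b) (x : Q) :
    innRho a • x ∈ MulAction.orbit N (innRho b • x) := by
  obtain ⟨n, rfl⟩ := h
  have hmem : (n : Inn Q) * (innRho b * (n : Inn Q)⁻¹ * (innRho b)⁻¹) ∈ N :=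
    N.mul_mem n.2 (hN.conj_mem _ (N.inv_mem n.2) _)
  refine ⟨⟨_, hmem⟩, ?_⟩
  change ((n : Inn Q) * (innRho b * (n : Inn Q)⁻¹ * (innRho b)⁻¹)) • innRho b • x =
    innRho ((n : Inn Q) • b) • x
  rw [innRho_smul, smul_smul]
  congr 1
  group

/-- The orbits of a normal subgroup of the inner automorphism group form a quandle. -/
noncomputable instance orbitQuotient : Quandle' (MulAction.orbitRel.Quotient N Q) where
  act := Quotient.map₂ (fun a b => a ◃ b) fun _ a' ha _ _ hb =>
    (MulAction.orbitRel N Q).trans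
      (innRho_smul_mem_orbit N hb _) ((innRho_smul_mem_orbit_iff N _ _ a').2 ha)
  act_bijective := by
    rintro ⟨a⟩
    constructor
    · rintro ⟨x⟩ ⟨y⟩ h
      exact Quotient.sound ((innRho_smul_mem_orbit_iff N a x y).1 (Quotient.exact h))
    · rintro ⟨y⟩
      obtain ⟨x, hx⟩ := (act_bijective a).2 y
      exact ⟨Quotient.mk _ x, congrArg (Quotient.mk _) hx⟩
  act_distrib := by
    rintro ⟨a⟩ ⟨b⟩ ⟨c⟩
    exact congrArg (Quotient.mk _) (act_distrib a b c)
  act_self := by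
    rintro ⟨a⟩
    exact congrArg (Quotient.mk _) (act_self a)

/-- Nontrivial normal subgroups of the inner automorphism group of a simple quandle
act transitively. -/
theorem IsSimple.mem_orbit_of_normal (hs : IsSimple Q) (hne : N ≠ ⊥) (a b : Q) :
    a ∈ MulAction.orbit N b := by
  rcases hs.2 (MulAction.orbitRel.Quotient N Q) (Quotient.mk _) (fun _ _ => rfl) with h | h
  · refine absurd ((Subgroup.eq_bot_iff_forall N).2 fun n hn => ?_) hne
    refine Subtype.ext (Equiv.ext fun x => ?_)
    exact h (Quotient.sound ⟨⟨n, hn⟩, rfl⟩)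
  · exact Quotient.exact (h a b)

end OrbitQuotient

/-- Proper quotients of the inner automorphism group of a simple quandle are cyclic. -/
theorem IsSimple.isCyclic_quotient (hs : IsSimple Q) (N : Subgroup (Inn Q)) [N.Normal]
    (hne : N ≠ ⊥) : IsCyclic (Inn Q ⧸ N) := by
  obtain ⟨a, -⟩ := hs.1
  have key : Subgroup.closure (Set.range (innRho : Q → Inn Q)) ≤
      (Subgroup.zpowers (innRho a : Inn Q ⧸ N)).comap (QuotientGroup.mk' N) := by
    rw [Subgroup.closure_le]
    rintro _ ⟨b, rfl⟩
    obtain ⟨n, rfl⟩ := hs.mem_orbit_of_normal N hne b a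
    have hn : ((n : Inn Q) : Inn Q ⧸ N) = 1 := (QuotientGroup.eq_one_iff _).2 n.2
    change ((innRho ((n : Inn Q) • a) : Inn Q) : Inn Q ⧸ N) ∈
      Subgroup.zpowers (innRho a : Inn Q ⧸ N)
    rw [innRho_smul, QuotientGroup.mk_mul, QuotientGroup.mk_mul, QuotientGroup.mk_inv, hn,
      one_mul, inv_one, mul_one]
    exact Subgroup.mem_zpowers _
  rw [closure_range_innRho] at key
  refine ⟨(innRho a : Inn Q ⧸ N), fun q => ?_⟩
  obtain ⟨g, rfl⟩ := QuotientGroup.mk_surjective q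
  exact key (Subgroup.mem_top g)

end Quandle'

/-- For a finite simple quandle `Q` whose cardinality is not a prime power,
every proper quotient of `G = Inn Q` is cyclic: the quotient of `G` by any
nontrivial normal subgroup is cyclic. -/
theorem simple_quandle_inn_proper_quotient_cyclic (Q : Type) [Quandle' Q] [Fintype Q]
    (hs : IsSimple Q) (hnpp : ¬ IsPrimePow (Fintype.card Q))
    (N : Subgroup (Inn Q)) (hN : N.Normal) (hne : N ≠ ⊥) :
    IsCyclic ((Inn Q) ⧸ N) := by
  exact hs.isCyclic_quotient N hne
end

section
/- Let p be an odd prime and let q ≥ 2 and d ≥ 2 be integers with 2p(q − 1) = q^d − 1. Then q is odd, d = 2, and q = 2p − 1 (equivalently, p = (q + 1)/2). -/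
/-- If `p` is an odd prime and `q ≥ 2`, `d ≥ 2` are integers with
`2p(q - 1) = q^d - 1`, then `q` is odd, `d = 2`, and `q = 2p - 1`
(equivalently, `p = (q + 1) / 2`). -/
theorem psl_one_spaces_degree_eq (p q d : ℕ) (hp : p.Prime) (hodd : Odd p)
    (hq : 2 ≤ q) (hd : 2 ≤ d) (h : 2 * p * (q - 1) = q ^ d - 1) :
    Odd q ∧ d = 2 ∧ q = 2 * p - 1 := by
  obtain ⟨k, rfl⟩ : ∃ k, q = k + 1 := ⟨q - 1, by omega⟩
  have hpow : (k + 1) ^ d = 2 * p * k + 1 := by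
    have := Nat.one_le_pow d (k + 1) (by omega)
    rw [Nat.add_sub_cancel] at h
    omega
  have hqodd : Odd (k + 1) := by
    have : Odd ((k + 1) ^ d) := hpow ▸ ⟨p * k, by ring⟩
    exact (Nat.odd_pow_iff (by omega)).1 this
  have geom (m : ℕ) : ∃ t, (k + 1) ^ (2 * m) = k * ((k + 2) * t) + 1 := by
    obtain ⟨t, ht⟩ := Nat.sub_dvd_pow_sub_pow ((k + 1) ^ 2) 1 m
    refine ⟨t, ?_⟩
    have hsq : (k + 1) ^ 2 - 1 = k * (k + 2) :=
      Nat.sub_eq_of_eq_add (by ring)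
    have := Nat.one_le_pow (2 * m) (k + 1) (by omega)
    rw [one_pow, ← pow_mul, hsq, mul_assoc] at ht
    omega
  have hk : 0 < k := by omega
  obtain ⟨m, rfl | rfl⟩ := Nat.even_or_odd' d
  · obtain ⟨t, ht⟩ := geom m
    have hfac : 2 * p = (k + 2) * t := Nat.eq_of_mul_eq_mul_left hk (by linarith)
    obtain ⟨j, hj⟩ := hqodd
    have hfac' : p = (j + 1) * t := by
      have : k + 2 = 2 * (j + 1) := by omega
      rw [this, mul_assoc] at hfac
      omega
    have hpj : j + 1 = p :=
      (hp.eq_one_or_self_of_dvd (j + 1) ⟨t, hfac'⟩).resolve_left (by omega)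
    refine ⟨⟨j, hj⟩, Nat.pow_right_injective hq ?_, by omega⟩
    have hkp : 2 * p = k + 2 := by omega
    change (k + 1) ^ (2 * m) = (k + 1) ^ 2
    rw [hpow, hkp]
    ring
  · obtain ⟨t, ht⟩ := geom m
    have hfac : 2 * p = (k + 1) * ((k + 2) * t) + 1 :=
      Nat.eq_of_mul_eq_mul_left hk (by rw [pow_succ, ht] at hpow; linarith)
    have heven : Even ((k + 1) * ((k + 2) * t)) := by
      rw [← mul_assoc]
      exact (Nat.even_mul_succ_self (k + 1)).mul_right t
    obtain ⟨s, hs⟩ := heven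
    omega
end
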